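/- Let C and D be monoidal categories, F : C ⥤ D a strong monoidal functor, and F ⊣ G an adjunction. Assume that C and D admit colimits indexed by the poset ℕ, that for every object c of C the functor − ⊗ c preserves ℕ-indexed colimits, that for every object e of D the functor − ⊗ e preserves ℕ-indexed colimits, and that G preserves ℕ-indexed colimits. Let X : ℕ ⥤ C be a diagram all of whose transition morphisms X(n) ⟶ X(n+1) are trace-class, and let x∞ be its colimit. Then for every object d of D, the projection morphism π_{x∞,d} : x∞ ⊗ G(d) ⟶ G(F(x∞) ⊗ d) is an isomorphism. -/

import Mathlib

open CategoryTheory MonoidalCategory Limits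

/-- A morphism `f : x ⟶ y` in a monoidal category is trace-class if there are
`d`, `ε : d ⊗ x ⟶ 𝟙` and `η : 𝟙 ⟶ y ⊗ d` such that `f` is the composite
`x ≅ 𝟙 ⊗ x ⟶ (y ⊗ d) ⊗ x ≅ y ⊗ (d ⊗ x) ⟶ y ⊗ 𝟙 ≅ y`. -/
def TraceClass {C : Type*} [Category C] [MonoidalCategory C] {x y : C} (f : x ⟶ y) : Prop :=
  ∃ (d : C) (ε : d ⊗ x ⟶ 𝟙_ C) (η : 𝟙_ C ⟶ y ⊗ d),
    f = (λ_ x).inv ≫ η ▷ x ≫ (α_ y d x).hom ≫ y ◁ ε ≫ (ρ_ y).hom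

/-- The projection morphism `π_{x,d} : x ⊗ G(d) ⟶ G(F(x) ⊗ d)` associated to an
adjunction `F ⊣ G` with `F` strong monoidal: the transpose of
`F(x ⊗ G(d)) ≅ F(x) ⊗ F(G(d)) ⟶ F(x) ⊗ d`. -/
noncomputable def projectionMorphism {C D : Type*} [Category C] [MonoidalCategory C]
    [Category D] [MonoidalCategory D] (F : C ⥤ D) [F.Monoidal] (G : D ⥤ C)
    (adj : F ⊣ G) (x : C) (d : D) : x ⊗ G.obj d ⟶ G.obj (F.obj x ⊗ d) :=
  adj.homEquiv _ _ (Functor.OplaxMonoidal.δ F x (G.obj d) ≫ F.obj x ◁ adj.counit.app d)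

section Helpers

variable {C D : Type*} [Category C] [MonoidalCategory C]
    [Category D] [MonoidalCategory D] (F : C ⥤ D) [F.Monoidal] (G : D ⥤ C)
    (adj : F ⊣ G)

open Functor.LaxMonoidal Functor.OplaxMonoidal

theorem isIso_of_interleaving {A B : ℕ ⥤ C} {cA : Cocone A} {cB : Cocone B}
    (hA : IsColimit cA) (hB : IsColimit cB)
    (p : ∀ n, A.obj n ⟶ B.obj n) (g : ∀ n, B.obj n ⟶ A.obj (n + 1))
    (h1 : ∀ n, p n ≫ g n = A.map (homOfLE (Nat.le_succ n)))
    (h2 : ∀ n, g n ≫ p (n + 1) = B.map (homOfLE (Nat.le_succ n)))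
    (φ : cA.pt ⟶ cB.pt) (hφ : ∀ n, cA.ι.app n ≫ φ = p n ≫ cB.ι.app n) : IsIso φ := by
  have key : ∀ n, B.map (homOfLE (Nat.le_succ n)) ≫ g (n + 1) ≫ cA.ι.app (n + 1 + 1)
      = g n ≫ cA.ι.app (n + 1) := by
    intro n
    rw [← h2, Category.assoc, reassoc_of% (h1 (n + 1)), cA.w]
  let c : Cocone B :=
    { pt := cA.pt
      ι := NatTrans.ofSequence (fun n => g n ≫ cA.ι.app (n + 1)) (by
        intro n
        simp only [Functor.const_obj_obj, Functor.const_obj_map, Category.comp_id]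
        exact key n) }
  have hc : ∀ n, cB.ι.app n ≫ hB.desc c = g n ≫ cA.ι.app (n + 1) := fun n => hB.fac c n
  refine ⟨hB.desc c, hA.hom_ext fun n => ?_, hB.hom_ext fun n => ?_⟩
  · rw [reassoc_of% (hφ n), hc, reassoc_of% (h1 n), cA.w, Category.comp_id]
  · rw [reassoc_of% (hc n), hφ, reassoc_of% (h2 n), cB.w, Category.comp_id]

theorem proj_def (x : C) (d : D) : projectionMorphism F G adj x d =
    adj.homEquiv (x ⊗ G.obj d) (F.obj x ⊗ d) (δ F x (G.obj d) ≫ F.obj x ◁ adj.counit.app d) := rfl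

theorem proj_nat_left {x y : C} (f : x ⟶ y) (d : D) :
    f ▷ G.obj d ≫ projectionMorphism F G adj y d =
      projectionMorphism F G adj x d ≫ G.map (F.map f ▷ d) := by
  unfold projectionMorphism
  rw [← adj.homEquiv_naturality_left, ← adj.homEquiv_naturality_right]
  congr 1
  rw [← δ_natural_left_assoc, Category.assoc, whisker_exchange]

theorem proj_nat_right (x : C) {d e : D} (f : d ⟶ e) :
    x ◁ G.map f ≫ projectionMorphism F G adj x e =
      projectionMorphism F G adj x d ≫ G.map (F.obj x ◁ f) := by
  unfold projectionMorphism
  rw [← adj.homEquiv_naturality_left, ← adj.homEquiv_naturality_right]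
  congr 1
  rw [← δ_natural_right_assoc, Category.assoc, ← whiskerLeft_comp, ← whiskerLeft_comp,
    adj.counit_naturality]

theorem proj_counit (x : C) (d : D) :
    F.map (projectionMorphism F G adj x d) ≫ adj.counit.app _ =
      δ F x (G.obj d) ≫ F.obj x ◁ adj.counit.app d := by
  unfold projectionMorphism
  exact (adj.homEquiv_counit _ _ _).symm.trans (Equiv.symm_apply_apply _ _)

theorem proj_unit (d : D) :
    projectionMorphism F G adj (𝟙_ C) d ≫ G.map (η F ▷ d ≫ (λ_ d).hom) =
      (λ_ (G.obj d)).hom := by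
  apply (adj.homEquiv _ _).symm.injective
  rw [adj.homEquiv_naturality_right_symm, projectionMorphism, Equiv.symm_apply_apply]
  simp only [Category.assoc, adj.homEquiv_counit]
  rw [whisker_exchange_assoc, leftUnitor_naturality, ← left_unitality_hom_assoc F]

theorem proj_tensor (x y : C) (d : D) :
    projectionMorphism F G adj (x ⊗ y) d ≫ G.map (δ F x y ▷ d ≫ (α_ _ _ _).hom) =
      (α_ _ _ _).hom ≫ x ◁ projectionMorphism F G adj y d ≫
        projectionMorphism F G adj x (F.obj y ⊗ d) := by
  apply (adj.homEquiv _ _).symm.injective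
  rw [adj.homEquiv_naturality_right_symm, adj.homEquiv_naturality_left_symm,
    adj.homEquiv_naturality_left_symm]
  simp only [proj_def F G adj (x ⊗ y), proj_def F G adj x,
    Equiv.symm_apply_apply]
  rw [← δ_natural_right_assoc, ← whiskerLeft_comp, proj_counit]
  simp only [Category.assoc, whiskerLeft_comp]
  rw [whisker_exchange_assoc, ← Functor.OplaxMonoidal.associativity_assoc F]
  simp

theorem map_trace {x y e : C} (ε' : e ⊗ x ⟶ 𝟙_ C) (η' : 𝟙_ C ⟶ y ⊗ e) :
    F.map ((λ_ x).inv ≫ η' ▷ x ≫ (α_ y e x).hom ≫ y ◁ ε' ≫ (ρ_ y).hom) =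
    (λ_ _).inv ≫ (ε F ≫ F.map η' ≫ δ F y e) ▷ F.obj x ≫ (α_ _ _ _).hom ≫
      F.obj y ◁ (μ F e x ≫ F.map ε' ≫ η F) ≫ (ρ_ _).hom := by
  simp only [Functor.map_comp, comp_whiskerRight, whiskerLeft_comp, Category.assoc,
    Functor.Monoidal.μ_δ_assoc, Functor.Monoidal.map_leftUnitor_inv, Functor.Monoidal.map_rightUnitor,
    Functor.Monoidal.map_associator, Functor.Monoidal.map_whiskerLeft,
    Functor.Monoidal.map_whiskerRight]

theorem trace_whisker {x y e : D} (ε' : e ⊗ x ⟶ 𝟙_ D) (η' : 𝟙_ D ⟶ y ⊗ e) (d : D) :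
    ((λ_ x).inv ≫ η' ▷ x ≫ (α_ y e x).hom ≫ y ◁ ε' ≫ (ρ_ y).hom) ▷ d =
    (λ_ _).inv ≫ η' ▷ (x ⊗ d) ≫ (α_ _ _ _).hom ≫
      y ◁ ((α_ _ _ _).inv ≫ ε' ▷ d ≫ (λ_ d).hom) := by
  simp only [comp_whiskerRight, whiskerRight_tensor, whiskerLeft_comp, whisker_assoc]
  monoidal

theorem exists_diag {x y : C} (f : x ⟶ y) (hf : TraceClass f) (d : D) :
    ∃ g : G.obj (F.obj x ⊗ d) ⟶ y ⊗ G.obj d,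
      projectionMorphism F G adj x d ≫ g = f ▷ G.obj d ∧
      g ≫ projectionMorphism F G adj y d = G.map (F.map f ▷ d) := by
  obtain ⟨e, ε', η', rfl⟩ := hf
  let h : F.obj e ⊗ (F.obj x ⊗ d) ⟶ d :=
    (α_ _ _ _).inv ≫ (μ F e x ≫ F.map ε' ≫ η F) ▷ d ≫ (λ_ d).hom
  have hh : e ◁ projectionMorphism F G adj x d ≫ projectionMorphism F G adj e _ ≫ G.map h =
      (α_ _ _ _).inv ≫ ε' ▷ G.obj d ≫ (λ_ _).hom := by
    rw [← cancel_epi (α_ _ _ _).hom]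
    rw [← reassoc_of% (proj_tensor F G adj e x d), ← G.map_comp, ← proj_unit F G adj d,
      Iso.hom_inv_id_assoc, reassoc_of% (proj_nat_left F G adj ε' d), ← G.map_comp]
    congr 2
    simp [h]
  refine ⟨(λ_ _).inv ≫ η' ▷ _ ≫ (α_ _ _ _).hom ≫
    y ◁ (projectionMorphism F G adj e _ ≫ G.map h), ?_, ?_⟩
  · rw [trace_whisker, leftUnitor_inv_naturality_assoc, whisker_exchange_assoc,
      ← hh]
    simp
  · rw [map_trace, trace_whisker]
    simp only [Category.assoc, whiskerLeft_comp]
    rw [proj_nat_right, ← reassoc_of% (proj_tensor F G adj y e (F.obj x ⊗ d)),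
      reassoc_of% (proj_nat_left F G adj η' (F.obj x ⊗ d)), Iso.inv_comp_eq,
      ← proj_unit F G adj]
    simp only [Category.assoc, ← G.map_comp]
    congr 2
    have h3 : η F ▷ F.obj x ▷ d ≫ ε F ▷ F.obj x ▷ d = 𝟙 _ := by
      rw [← comp_whiskerRight, ← comp_whiskerRight, Functor.Monoidal.η_ε]
      simp
    simp [h, reassoc_of% h3]

end Helpers

/-- If `X : ℕ ⥤ C` is a sequential diagram all of whose transition maps are
trace-class, with colimit `x∞`, then (under suitable colimit-preservation
hypotheses) the projection morphism `π_{x∞,d}` is an isomorphism for all `d`. -/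
theorem stmt_9 {C D : Type*} [Category C] [MonoidalCategory C]
    [Category D] [MonoidalCategory D] (F : C ⥤ D) [F.Monoidal] (G : D ⥤ C)
    (adj : F ⊣ G)
    [HasColimitsOfShape ℕ C] [HasColimitsOfShape ℕ D]
    (hC : ∀ c : C, PreservesColimitsOfShape ℕ (tensorRight c))
    (hD : ∀ e : D, PreservesColimitsOfShape ℕ (tensorRight e))
    [PreservesColimitsOfShape ℕ G]
    (X : ℕ ⥤ C) (hX : ∀ n : ℕ, TraceClass (X.map (homOfLE (Nat.le_succ n))))
    (d : D) :
    IsIso (projectionMorphism F G adj (colimit X) d) := by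
  choose g h1 h2 using fun n => exists_diag F G adj _ (hX n) d
  have := hC (G.obj d)
  have := hD d
  have : PreservesColimitsOfSize.{0, 0} F := adj.leftAdjoint_preservesColimits
  exact isIso_of_interleaving (A := X ⋙ tensorRight (G.obj d))
    (B := X ⋙ F ⋙ tensorRight d ⋙ G)
    (isColimitOfPreserves (tensorRight (G.obj d)) (colimit.isColimit X))
    (isColimitOfPreserves (F ⋙ tensorRight d ⋙ G) (colimit.isColimit X))
    (fun n => projectionMorphism F G adj (X.obj n) d) g h1 h2 _
    (fun n => proj_nat_left F G adj (colimit.ι X n) d)
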